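/- arXiv:0901.1364 — 3 statements merged into one kernel-verified Lean document; each statement's English description precedes it below -/
import Mathlib

section
/- Let (κ_t)_{t≥0} be a monotone Feller Markov semigroup on the configuration space X, and set μ_t := δ_0 κ_t (the law at time t when the process starts from the empty configuration). Then: (i) μ_s ⪯ μ_t whenever 0 ≤ s ≤ t; (ii) μ_t converges weakly as t → ∞ to a probability measure μ_∞; (iii) μ_∞ is invariant; (iv) μ_∞ ⪯ ν for every invariant probability measure ν, i.e. μ_∞ is the smallest invariant measure; (v) μ_∞ is extremal: if μ_∞ = λ • ν₁ + (1−λ) • ν₂ with ν₁, ν₂ invariant probability measures and λ ∈ (0,1), then ν₁ = ν₂ = μ_∞. -/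
open MeasureTheory Filter Topology ProbabilityTheory
open scoped NNReal

/-- The configuration space `X = {0,1}^ℕ` (with the product topology, pointwise order
and Borel σ-algebra, all provided by the standard instances). -/
abbrev Config : Type := ℕ → Bool

/-- Stochastic domination: `μ ⪯ ν` iff `∫ f dμ ≤ ∫ f dν` for every continuous monotone
`f : X → ℝ`. -/
def StochDom (μ ν : Measure Config) : Prop :=
  ∀ f : Config → ℝ, Continuous f → Monotone f → ∫ x, f x ∂μ ≤ ∫ x, f x ∂ν

/-- The law at time `t` of the process started from the empty configuration:
`μ_t = δ_0 κ_t`. -/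
noncomputable def lawFromEmpty (κ : ℝ≥0 → Kernel Config Config) (t : ℝ≥0) :
    Measure Config :=
  (Measure.dirac (fun _ => false : Config)).bind (κ t)

/-- Continuous functions on the compact configuration space are integrable. -/
lemma config_integrable (μ : Measure Config) [IsFiniteMeasure μ] {f : Config → ℝ}
    (hf : Continuous f) : Integrable f μ :=
  hf.integrable_of_hasCompactSupport (HasCompactSupport.of_compactSpace f)

/-- Integration against `μκ`. -/
lemma config_integral_bind (μ : Measure Config) [IsProbabilityMeasure μ]
    (η : Kernel Config Config) [IsMarkovKernel η] {f : Config → ℝ} (hf : Continuous f) :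
    ∫ x, f x ∂(μ.bind η) = ∫ x, ∫ y, f y ∂(η x) ∂μ := by
  have h := Kernel.integral_comp (a := ()) (κ := Kernel.const Unit μ) (η := η) (f := f)
    (config_integrable _ hf)
  rwa [Kernel.comp_apply, Kernel.const_apply] at h

/-- The increasing cylinder `{x | x = 1 on F}`. -/
def upCyl (F : Finset ℕ) : Set Config := {x | ∀ i ∈ F, x i = true}

lemma isClopen_upCyl (F : Finset ℕ) : IsClopen (upCyl F) := by
  have : upCyl F = ⋂ i ∈ F, (fun x : Config => x i) ⁻¹' {true} := by
    ext x; simp [upCyl]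
  rw [this]
  exact isClopen_biInter_finset fun i _ => (isClopen_discrete _).preimage (continuous_apply i)

lemma generateFrom_upCyl :
    (inferInstance : MeasurableSpace Config) = MeasurableSpace.generateFrom (Set.range upCyl) := by
  apply le_antisymm
  · refine iSup_le fun i => ?_
    rw [← measurable_iff_comap_le]
    refine @measurable_to_bool _ (MeasurableSpace.generateFrom (Set.range upCyl)) _ ?_
    apply MeasurableSpace.measurableSet_generateFrom
    refine ⟨{i}, ?_⟩
    ext x; simp [upCyl]
  · apply MeasurableSpace.generateFrom_le
    rintro _ ⟨F, rfl⟩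
    exact (isClopen_upCyl F).isOpen.measurableSet

/-- Continuous monotone functions determine probability measures. -/
lemma config_ext (μ ν : Measure Config) [IsProbabilityMeasure μ] [IsProbabilityMeasure ν]
    (h : ∀ f : Config → ℝ, Continuous f → Monotone f → ∫ x, f x ∂μ = ∫ x, f x ∂ν) : μ = ν := by
  refine ext_of_generate_finite _ generateFrom_upCyl ?_ ?_ (by simp)
  · rintro _ ⟨F, rfl⟩ _ ⟨G, rfl⟩ -
    refine ⟨F ∪ G, ?_⟩
    ext x
    simp only [upCyl, Finset.mem_union, Set.mem_ofPred_eq, Set.mem_inter_iff]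
    grind
  · rintro _ ⟨F, rfl⟩
    have hm := (isClopen_upCyl F).isOpen.measurableSet
    have h1 := h ((upCyl F).indicator fun _ => (1 : ℝ))
      ((isClopen_upCyl F).continuous_indicator continuous_const) ?_
    · rw [integral_indicator_const _ hm, integral_indicator_const _ hm] at h1
      simpa [measureReal_def, ENNReal.toReal_eq_toReal_iff'] using h1
    · intro x y hxy
      by_cases hx : x ∈ upCyl F
      · have hy : y ∈ upCyl F := fun i hi => by
          have h2 := hxy i
          rw [hx i hi] at h2
          exact Bool.eq_true_of_true_le h2
        simp [hx, hy]
      · simp only [Set.indicator_of_notMem hx]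
        exact Set.indicator_nonneg (fun _ _ => zero_le_one) y

lemma stochDom_empty (ν : Measure Config) [IsProbabilityMeasure ν] :
    StochDom (Measure.dirac (fun _ => false : Config)) ν := by
  intro f hf hm
  rw [integral_dirac]
  calc f (fun _ => false) = ∫ _, f (fun _ => false) ∂ν := by simp
    _ ≤ _ := integral_mono (integrable_const _) (config_integrable ν hf)
      fun x => hm fun i => Bool.false_le _

/-- For a monotone Feller Markov semigroup `(κ_t)` on `X` and `μ_t := δ_0 κ_t`:
(i) `(μ_t)` is stochastically increasing; (ii) `μ_t` converges weakly to a probability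
measure `μ_∞`; (iii) `μ_∞` is invariant; (iv) `μ_∞ ⪯ ν` for every invariant probability
measure `ν`; (v) `μ_∞` is extremal among invariant measures. -/
theorem smallest_invariant_measure
    (κ : ℝ≥0 → Kernel Config Config)
    (hmk : ∀ t, IsMarkovKernel (κ t))
    (h0 : κ 0 = Kernel.id)
    (hsg : ∀ s t : ℝ≥0, κ (s + t) = κ s ∘ₖ κ t)
    (hmono : ∀ (t : ℝ≥0) (μ ν : Measure Config), IsProbabilityMeasure μ →
      IsProbabilityMeasure ν → StochDom μ ν → StochDom (μ.bind (κ t)) (ν.bind (κ t)))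
    (hfeller : ∀ (t : ℝ≥0) (f : Config → ℝ), Continuous f →
      Continuous fun x => ∫ y, f y ∂(κ t x)) :
    (∀ s t : ℝ≥0, s ≤ t → StochDom (lawFromEmpty κ s) (lawFromEmpty κ t)) ∧
    ∃ μ' : Measure Config, IsProbabilityMeasure μ' ∧
      (∀ f : Config → ℝ, Continuous f →
        Tendsto (fun t => ∫ x, f x ∂(lawFromEmpty κ t)) atTop (𝓝 (∫ x, f x ∂μ'))) ∧
      (∀ t, μ'.bind (κ t) = μ') ∧
      (∀ ν : Measure Config, IsProbabilityMeasure ν → (∀ t, ν.bind (κ t) = ν) →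
        StochDom μ' ν) ∧
      (∀ (l : ℝ) (ν₁ ν₂ : Measure Config), 0 < l → l < 1 →
        IsProbabilityMeasure ν₁ → IsProbabilityMeasure ν₂ →
        (∀ t, ν₁.bind (κ t) = ν₁) → (∀ t, ν₂.bind (κ t) = ν₂) →
        μ' = ENNReal.ofReal l • ν₁ + ENNReal.ofReal (1 - l) • ν₂ →
        ν₁ = μ' ∧ ν₂ = μ') := by
  have hlp : ∀ t, IsProbabilityMeasure (lawFromEmpty κ t) := fun t => by
    unfold lawFromEmpty; infer_instance
  have hadd : ∀ s t, lawFromEmpty κ (s + t) = (lawFromEmpty κ t).bind (κ s) := fun s t => by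
    simp only [lawFromEmpty]
    rw [Measure.dirac_bind (κ _).measurable, Measure.dirac_bind (κ _).measurable, hsg,
      Kernel.comp_apply]
  have hi : ∀ s t : ℝ≥0, s ≤ t → StochDom (lawFromEmpty κ s) (lawFromEmpty κ t) := by
    intro s t hst
    rw [← add_tsub_cancel_of_le hst, hadd]
    exact hmono s _ _ inferInstance inferInstance (stochDom_empty _)
  refine ⟨hi, ?_⟩
  let P : ℝ≥0 → ProbabilityMeasure Config := fun t => ⟨lawFromEmpty κ t, hlp t⟩
  obtain ⟨Q, hQ⟩ := exists_clusterPt_of_compactSpace (Filter.map P atTop)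
  -- along monotone functions the integrals converge to the value at any cluster point
  have key : ∀ R : ProbabilityMeasure Config, MapClusterPt R atTop P →
      ∀ f : Config → ℝ, Continuous f → Monotone f →
      Tendsto (fun t => ∫ x, f x ∂(lawFromEmpty κ t)) atTop (𝓝 (∫ x, f x ∂(R : Measure Config))) := by
    intro R hR f hf hm
    obtain ⟨U, hU, hUt⟩ := mapClusterPt_iff_ultrafilter.1 hR
    have h1 := ProbabilityMeasure.tendsto_iff_forall_integral_tendsto.1 hUt
      (BoundedContinuousFunction.mkOfCompact ⟨f, hf⟩)
    have h1 : Tendsto (fun t => ∫ x, f x ∂(lawFromEmpty κ t)) U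
      (𝓝 (∫ x, f x ∂(R : Measure Config))) := h1
    have hmon : Monotone (fun t => ∫ x, f x ∂(lawFromEmpty κ t)) :=
      fun s t hst => hi s t hst f hf hm
    have hbdd : BddAbove (Set.range fun t => ∫ x, f x ∂(lawFromEmpty κ t)) := by
      refine ⟨f fun _ => true, ?_⟩
      rintro _ ⟨t, rfl⟩
      calc ∫ x, f x ∂(lawFromEmpty κ t) ≤ ∫ _, f (fun _ => true) ∂(lawFromEmpty κ t) :=
            integral_mono (config_integrable _ hf) (integrable_const _)
              fun x => hm fun i => Bool.le_true _
        _ = _ := by simp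
    have h2 := tendsto_atTop_ciSup hmon hbdd
    rwa [tendsto_nhds_unique h1 (h2.mono_left hU)]
  have hT : Tendsto P atTop (𝓝 Q) := by
    apply tendsto_nhds_of_unique_mapClusterPt
    intro R hR
    apply Subtype.ext
    exact config_ext (R : Measure Config) (Q : Measure Config) fun f hf hm =>
      tendsto_nhds_unique (key R hR f hf hm) (key Q hQ f hf hm)
  have hlim : ∀ f : Config → ℝ, Continuous f →
      Tendsto (fun t => ∫ x, f x ∂(lawFromEmpty κ t)) atTop
        (𝓝 (∫ x, f x ∂(Q : Measure Config))) := fun f hf =>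
    ProbabilityMeasure.tendsto_iff_forall_integral_tendsto.1 hT
      (BoundedContinuousFunction.mkOfCompact ⟨f, hf⟩)
  have hiv : ∀ ν : Measure Config, IsProbabilityMeasure ν → (∀ t, ν.bind (κ t) = ν) →
        StochDom (Q : Measure Config) ν := by
    intro ν hν hinv f hf hm
    refine le_of_tendsto' (hlim f hf) fun t => ?_
    have := hmono t _ ν inferInstance hν (stochDom_empty ν) f hf hm
    rwa [hinv t] at this
  refine ⟨Q, inferInstance, hlim, ?_, hiv, ?_⟩
  · intro t
    refine config_ext _ _ fun f hf _ => ?_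
    rw [config_integral_bind _ _ hf]
    have h1 := hlim _ (hfeller t f hf)
    have h2 := (hlim f hf).comp
      (tendsto_atTop_mono (fun s => (le_add_self : s ≤ t + s)) tendsto_id)
    refine tendsto_nhds_unique h1 (h2.congr fun s => ?_)
    simp only [Function.comp]
    rw [hadd, config_integral_bind _ _ hf]
  · intro l ν₁ ν₂ hl0 hl1 hp1 hp2 hinv1 hinv2 hQ'
    have hE : ∀ f : Config → ℝ, Continuous f → Monotone f →
        ∫ x, f x ∂ν₁ = ∫ x, f x ∂(Q : Measure Config) ∧
        ∫ x, f x ∂ν₂ = ∫ x, f x ∂(Q : Measure Config) := by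
      intro f hf hm
      have a := hiv ν₁ hp1 hinv1 f hf hm
      have b := hiv ν₂ hp2 hinv2 f hf hm
      have c : ∫ x, f x ∂(Q : Measure Config) = l * ∫ x, f x ∂ν₁ + (1 - l) * ∫ x, f x ∂ν₂ := by
        rw [hQ', integral_add_measure
          ((config_integrable ν₁ hf).smul_measure ENNReal.ofReal_ne_top)
          ((config_integrable ν₂ hf).smul_measure ENNReal.ofReal_ne_top),
          integral_smul_measure, integral_smul_measure, ENNReal.toReal_ofReal hl0.le,
          ENNReal.toReal_ofReal (by linarith)]
        simp
      constructor <;> nlinarith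
    exact ⟨config_ext _ _ fun f hf hm => (hE f hf hm).1,
      config_ext _ _ fun f hf hm => (hE f hf hm).2⟩
end

section
/- Let (μ_t)_{t≥0} be a family of probability measures on the configuration space X that is stochastically increasing, i.e. μ_s ⪯ μ_t whenever 0 ≤ s ≤ t. Then μ_t converges weakly as t → ∞ to a probability measure on X. -/
open MeasureTheory Filter Topology ProbabilityTheory
open scoped NNReal

def monoM : Submonoid C(Config, ℝ) where
  carrier := {f | (∀ x, 0 ≤ f x) ∧ Monotone f}
  one_mem' := ⟨fun _ => zero_le_one, fun _ _ _ => le_rfl⟩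
  mul_mem' := by
    rintro f g ⟨hf, hf'⟩ ⟨hg, hg'⟩
    refine ⟨fun x => mul_nonneg (hf x) (hg x), fun x y h => ?_⟩
    exact mul_le_mul (hf' h) (hg' h) (hg x) (hf y)

theorem monoM_dense (f : C(Config, ℝ)) :
    f ∈ closure (Submodule.span ℝ (monoM : Set C(Config, ℝ)) : Set C(Config, ℝ)) := by
  have h := ContinuousMap.subalgebra_topologicalClosure_eq_top_of_separatesPoints
    (Algebra.adjoin ℝ (monoM : Set C(Config, ℝ))) (by
      intro x y hxy
      obtain ⟨n, hn⟩ := Function.ne_iff.1 hxy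
      let g : C(Config, ℝ) := ⟨fun x => if x n then 1 else 0,
        (continuous_of_discreteTopology (f := fun b : Bool => if b then (1:ℝ) else 0)).comp
          (continuous_apply n)⟩
      refine ⟨g, ⟨g, Algebra.subset_adjoin ⟨?_, ?_⟩, rfl⟩, ?_⟩
      · intro x
        change (0:ℝ) ≤ if x n then 1 else 0
        split_ifs <;> norm_num
      · intro x y h
        change (if x n then (1:ℝ) else 0) ≤ if y n then 1 else 0
        have h' : x n = true → y n = true := h n
        cases hx : x n <;> cases hy : y n <;> simp_all
      · change (if x n then (1:ℝ) else 0) ≠ if y n then 1 else 0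
        cases hx : x n <;> cases hy : y n <;> simp_all)
  have h2 : f ∈ (Algebra.adjoin ℝ (monoM : Set C(Config, ℝ))).topologicalClosure := by
    rw [h]; trivial
  have h3 : ((Algebra.adjoin ℝ (monoM : Set C(Config, ℝ)) : Subalgebra ℝ C(Config, ℝ)) :
      Set C(Config, ℝ)) = Submodule.span ℝ (monoM : Set C(Config, ℝ)) := by
    have := Algebra.adjoin_eq_span ℝ (monoM : Set C(Config, ℝ))
    rw [Submonoid.closure_eq] at this
    rw [← this]; rfl
  rw [← h3]
  exact h2

theorem integrable_config (ν : Measure Config) [IsProbabilityMeasure ν] (f : C(Config, ℝ)) :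
    Integrable f ν :=
  f.continuous.integrable_of_hasCompactSupport (HasCompactSupport.of_compactSpace f)

theorem integral_close (ν : Measure Config) [IsProbabilityMeasure ν] (f g : C(Config, ℝ)) :
    |∫ x, f x ∂ν - ∫ x, g x ∂ν| ≤ dist f g := by
  rw [← integral_sub (integrable_config ν f) (integrable_config ν g)]
  have := norm_integral_le_of_norm_le_const (μ := ν) (f := fun x => f x - g x) (C := dist f g)
    (Eventually.of_forall fun x => by
      rw [← dist_eq_norm]
      exact ContinuousMap.dist_apply_le_dist x)
  simpa using this

/-- A stochastically increasing family `(μ_t)_{t ≥ 0}` of probability measures on `X`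
converges weakly as `t → ∞` to a probability measure on `X`. -/
theorem stochastically_increasing_weak_limit
    (μ : ℝ≥0 → Measure Config)
    (hprob : ∀ t, IsProbabilityMeasure (μ t))
    (hincr : ∀ s t : ℝ≥0, s ≤ t → StochDom (μ s) (μ t)) :
    ∃ μ' : Measure Config, IsProbabilityMeasure μ' ∧
      ∀ f : Config → ℝ, Continuous f →
        Tendsto (fun t => ∫ x, f x ∂(μ t)) atTop (𝓝 (∫ x, f x ∂μ')) := by
  let P : ℝ≥0 → ProbabilityMeasure Config := fun t => ⟨μ t, hprob t⟩
  let U : Ultrafilter ℝ≥0 := Ultrafilter.of atTop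
  have hU : (U : Filter ℝ≥0) ≤ atTop := Ultrafilter.of_le _
  obtain ⟨ν, -, hν⟩ := isCompact_univ.ultrafilter_le_nhds (U.map P) (by simp)
  have hν' : Tendsto P U (𝓝 ν) := hν
  rw [ProbabilityMeasure.tendsto_iff_forall_integral_tendsto] at hν'
  refine ⟨ν, inferInstance, ?_⟩
  have key : ∀ f ∈ Submodule.span ℝ (monoM : Set C(Config, ℝ)),
      Tendsto (fun t => ∫ x, f x ∂(μ t)) atTop (𝓝 (∫ x, f x ∂(ν : Measure Config))) := by
    intro f hf
    induction hf using Submodule.span_induction with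
    | mem f hf =>
      have hm : Monotone (fun t => ∫ x, f x ∂(μ t)) :=
        fun s t h => hincr s t h f f.continuous hf.2
      have hb : BddAbove (Set.range (fun t => ∫ x, f x ∂(μ t))) := by
        refine ⟨dist f 0, ?_⟩
        rintro _ ⟨t, rfl⟩
        have := integral_close (μ t) f 0
        simp only [ContinuousMap.zero_apply, integral_zero, sub_zero] at this
        exact (le_abs_self _).trans this
      have h1 := tendsto_atTop_ciSup hm hb
      have h2 := hν' (BoundedContinuousFunction.mkOfCompact f)
      have h3 := tendsto_nhds_unique (h1.mono_left hU) h2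
      rw [h3] at h1
      exact h1
    | zero => simp
    | add f g _ _ hf hg =>
      have e : ∀ (ρ : Measure Config) [IsProbabilityMeasure ρ],
          ∫ x, (f + g) x ∂ρ = ∫ x, f x ∂ρ + ∫ x, g x ∂ρ := fun ρ _ =>
        integral_add (integrable_config ρ f) (integrable_config ρ g)
      rw [e]
      simp_rw [fun t => e (μ t)]
      exact hf.add hg
    | smul c f _ hf =>
      have e : ∀ (ρ : Measure Config), ∫ x, (c • f) x ∂ρ = c * ∫ x, f x ∂ρ := fun ρ =>
        integral_const_mul c f
      rw [e]
      simp_rw [e]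
      exact hf.const_mul c
  intro f hf
  let F : C(Config, ℝ) := ⟨f, hf⟩
  rw [Metric.tendsto_nhds]
  intro ε hε
  obtain ⟨g, hg, hfg⟩ := Metric.mem_closure_iff.1 (monoM_dense F) (ε / 3) (by positivity)
  filter_upwards [Metric.tendsto_nhds.1 (key g hg) (ε / 3) (by positivity)] with t ht
  have a := integral_close (μ t) F g
  have b := integral_close (ν : Measure Config) F g
  change |∫ x, f x ∂(μ t) - _| ≤ _ at a
  change |∫ x, f x ∂(ν : Measure Config) - _| ≤ _ at b
  rw [Real.dist_eq] at ht ⊢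
  rw [abs_le] at a b
  rw [abs_lt] at ht ⊢
  constructor <;> linarith [a.1, a.2, b.1, b.2, ht.1, ht.2]
end

section
/- Stochastic domination on the configuration space X is antisymmetric: if μ and ν are probability measures on X with μ ⪯ ν and ν ⪯ μ, then μ = ν. -/
open MeasureTheory Filter Topology
open scoped NNReal

/-- Stochastic domination is antisymmetric on probability measures on `X`. -/
theorem stochDom_antisymm
    (μ ν : Measure Config) (hμ : IsProbabilityMeasure μ) (hν : IsProbabilityMeasure ν)
    (h₁ : StochDom μ ν) (h₂ : StochDom ν μ) :
    μ = ν := by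
  classical
  let A : Finset ℕ → Set Config := fun s => {x | ∀ i ∈ s, x i = true}
  have hclopen : ∀ s, IsClopen (A s) := by
    intro s
    have : A s = ⋂ i ∈ s, (fun x : Config => x i) ⁻¹' {true} := by
      ext x; simp [A]
    rw [this]
    exact isClopen_biInter_finset fun i _ =>
      (isClopen_discrete ({true} : Set Bool)).preimage (continuous_apply i)
  have hmeas : ∀ s, MeasurableSet (A s) := fun s => (hclopen s).isOpen.measurableSet
  refine ext_of_generate_finite (Set.range A) ?_ ?_ ?_ (by simp)
  · apply le_antisymm
    · refine iSup_le fun i => ?_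
      rw [← measurable_iff_comap_le]
      refine measurable_to_bool ?_
      refine MeasurableSpace.measurableSet_generateFrom ⟨{i}, ?_⟩
      ext x; simp [A]
    · refine MeasurableSpace.generateFrom_le ?_
      rintro _ ⟨s, rfl⟩
      exact hmeas s
  · rintro _ ⟨s, rfl⟩ _ ⟨t, rfl⟩ _
    refine ⟨s ∪ t, ?_⟩
    ext x
    simp only [A, Finset.mem_union, Set.mem_setOf_eq, Set.mem_inter_iff]
    grind
  · rintro _ ⟨s, rfl⟩
    have hc : Continuous ((A s).indicator (fun _ => (1 : ℝ))) :=
      continuous_const.indicator (by simp [(hclopen s).frontier_eq])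
    have hm : Monotone ((A s).indicator (fun _ => (1 : ℝ))) := by
      intro x y hxy
      by_cases hx : x ∈ A s
      · have hy : y ∈ A s := fun i hi => by
          have h := hxy i
          rw [hx i hi] at h
          exact top_le_iff.mp h
        simp [hx, hy]
      · rw [Set.indicator_of_notMem hx]
        exact Set.indicator_nonneg (fun _ _ => zero_le_one) y
    have h := le_antisymm (h₁ _ hc hm) (h₂ _ hc hm)
    rw [integral_indicator_const _ (hmeas s), integral_indicator_const _ (hmeas s)] at h
    simp only [smul_eq_mul, mul_one] at h
    exact (measureReal_eq_measureReal_iff).mp h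
end
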